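/- Let φ: X → G be a central Γ-equivariant extension of a Γ-perfect Γ-group G, and let X' = [X,X]_Γ be the Γ-commutator subgroup of X. Then X' is Γ-perfect (i.e. X' = [X',X']_Γ) and φ maps X' onto G. -/

import Mathlib

/-- The Γ-commutator subgroup `[G,G]_Γ` of a Γ-group `G`: the subgroup generated by all
commutators together with the elements `(σ • g) * g⁻¹`. -/
def gammaCommutator (Γ G : Type*) [Group Γ] [Group G] [MulDistribMulAction Γ G] : Subgroup G :=
  Subgroup.closure ({x | ∃ a b : G, x = a * b * a⁻¹ * b⁻¹} ∪
    {x | ∃ (σ : Γ) (g : G), x = σ • g * g⁻¹})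

instance gammaCommutator_normal (Γ G : Type*) [Group Γ] [Group G] [MulDistribMulAction Γ G] :
    (gammaCommutator Γ G).Normal := by
  constructor
  intro n hn g
  have h1 : g * n * g⁻¹ * n⁻¹ ∈ gammaCommutator Γ G :=
    Subgroup.subset_closure (Or.inl ⟨g, n, rfl⟩)
  have h2 := mul_mem h1 hn
  simpa [mul_assoc] using h2

theorem gammaCommutator_smul_mem {Γ G : Type*} [Group Γ] [Group G] [MulDistribMulAction Γ G]
    (σ : Γ) {x : G} (hx : x ∈ gammaCommutator Γ G) : σ • x ∈ gammaCommutator Γ G := by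
  induction hx using Subgroup.closure_induction with
  | mem y hy =>
    rcases hy with ⟨a, b, rfl⟩ | ⟨τ, g, rfl⟩
    · refine Subgroup.subset_closure (Or.inl ⟨σ • a, σ • b, ?_⟩)
      simp [smul_mul', smul_inv']
    · refine Subgroup.subset_closure (Or.inr ⟨σ * τ * σ⁻¹, σ • g, ?_⟩)
      rw [smul_mul', smul_inv', ← mul_smul, ← mul_smul]
      simp [mul_assoc]
  | one => simpa using one_mem (gammaCommutator Γ G)
  | mul a b _ _ iha ihb => rw [smul_mul']; exact mul_mem iha ihb
  | inv a _ iha => rw [smul_inv']; exact inv_mem iha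

instance gammaCommutatorAction (Γ G : Type*) [Group Γ] [Group G] [MulDistribMulAction Γ G] :
    MulDistribMulAction Γ (gammaCommutator Γ G) where
  smul σ x := ⟨σ • (x : G), gammaCommutator_smul_mem σ x.2⟩
  one_smul x := Subtype.ext (one_smul Γ (x : G))
  mul_smul σ τ x := Subtype.ext (mul_smul σ τ (x : G))
  smul_mul σ x y := Subtype.ext (smul_mul' σ (x : G) (y : G))
  smul_one σ := Subtype.ext (smul_one σ)

instance gammaAbelianization_commGroup (Γ G : Type*) [Group Γ] [Group G]
    [MulDistribMulAction Γ G] : CommGroup (G ⧸ gammaCommutator Γ G) where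
  mul_comm a b := by
    induction a using QuotientGroup.induction_on with
    | _ x =>
    induction b using QuotientGroup.induction_on with
    | _ y =>
    rw [← QuotientGroup.mk_mul, ← QuotientGroup.mk_mul, QuotientGroup.eq]
    exact Subgroup.subset_closure (Or.inl ⟨y⁻¹, x⁻¹, by group⟩)

universe u v

/-- `φ : B →* G` is a central Γ-equivariant extension of the Γ-group `G`. -/
def IsCentralGammaExt (Γ : Type u) [Group Γ] {B G : Type v} [Group B] [Group G]
    [MulDistribMulAction Γ B] [MulDistribMulAction Γ G] (φ : B →* G) : Prop :=
  (∀ (σ : Γ) (b : B), φ (σ • b) = σ • φ b) ∧ Function.Surjective φ ∧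
    φ.ker ≤ Subgroup.center B ∧ (∀ (σ : Γ), ∀ b ∈ φ.ker, σ • b = b) ∧
    ∃ γ : G → B, (∀ (σ : Γ) (g : G), γ (σ • g) = σ • γ g) ∧ ∀ g, φ (γ g) = g

/-- A central Γ-equivariant extension `β : U →* G` is universal if for every central
Γ-equivariant extension `α : X →* G` there is a unique Γ-homomorphism `U →* X` over `G`. -/
def IsUniversalCentralGammaExt (Γ : Type u) [Group Γ] {U G : Type v} [Group U] [Group G]
    [MulDistribMulAction Γ U] [MulDistribMulAction Γ G] (β : U →* G) : Prop :=
  IsCentralGammaExt Γ β ∧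
    ∀ (X : Type v) [Group X] [MulDistribMulAction Γ X] (α : X →* G),
      IsCentralGammaExt Γ α →
        ∃! f : U →* X, (∀ (σ : Γ) (u : U), f (σ • u) = σ • f u) ∧ α.comp f = β

/-- The Γ-commutator subgroup `[K,K]_Γ` of a Γ-invariant subgroup `K` of a Γ-group,
computed inside the ambient group: it is generated by the commutators of elements of `K`
together with the elements `(σ • a) * a⁻¹` with `a ∈ K`. -/
def gammaCommutatorOn {Γ G : Type*} [Group Γ] [Group G] [MulDistribMulAction Γ G]
    (K : Subgroup G) : Subgroup G :=
  Subgroup.closure ({x | ∃ a ∈ K, ∃ b ∈ K, x = a * b * a⁻¹ * b⁻¹} ∪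
    {x | ∃ (σ : Γ), ∃ a ∈ K, x = σ • a * a⁻¹})

/-- A Γ-equivariant surjection maps the Γ-commutator subgroup onto the Γ-commutator subgroup. -/
theorem gammaCommutator_le_map {Γ X G : Type*} [Group Γ] [Group X] [Group G]
    [MulDistribMulAction Γ X] [MulDistribMulAction Γ G] (φ : X →* G)
    (hsmul : ∀ (σ : Γ) (x : X), φ (σ • x) = σ • φ x) (hsurj : Function.Surjective φ) :
    gammaCommutator Γ G ≤ (gammaCommutator Γ X).map φ := by
  refine (Subgroup.closure_le _).2 ?_
  rintro _ (⟨a, b, rfl⟩ | ⟨σ, a, rfl⟩)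
  · obtain ⟨x, rfl⟩ := hsurj a
    obtain ⟨y, rfl⟩ := hsurj b
    exact ⟨x * y * x⁻¹ * y⁻¹, Subgroup.subset_closure (Or.inl ⟨x, y, rfl⟩), by simp⟩
  · obtain ⟨x, rfl⟩ := hsurj a
    exact ⟨σ • x * x⁻¹, Subgroup.subset_closure (Or.inr ⟨σ, x, rfl⟩), by simp [hsmul]⟩

/-- The Γ-commutator subgroup of a Γ-invariant subgroup is contained in that subgroup. -/
theorem gammaCommutatorOn_le {Γ G : Type*} [Group Γ] [Group G] [MulDistribMulAction Γ G]
    {K : Subgroup G} (hK : ∀ (σ : Γ), ∀ x ∈ K, σ • x ∈ K) :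
    gammaCommutatorOn (Γ := Γ) K ≤ K := by
  refine (Subgroup.closure_le _).2 ?_
  rintro _ (⟨a, ha, b, hb, rfl⟩ | ⟨σ, a, ha, rfl⟩)
  · exact mul_mem (mul_mem (mul_mem ha hb) (inv_mem ha)) (inv_mem hb)
  · exact mul_mem (hK σ a ha) (inv_mem ha)

/-- If every element of `G` is the product of an element of `K` and a central Γ-fixed element,
then the Γ-commutator subgroup of `G` is already generated by `K`. -/
theorem gammaCommutator_le_gammaCommutatorOn {Γ G : Type*} [Group Γ] [Group G]
    [MulDistribMulAction Γ G] {K : Subgroup G}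
    (h : ∀ x : G, ∃ k ∈ K, ∃ z ∈ Subgroup.center G, (∀ σ : Γ, σ • z = z) ∧ x = k * z) :
    gammaCommutator Γ G ≤ gammaCommutatorOn (Γ := Γ) K := by
  refine (Subgroup.closure_le _).2 ?_
  rintro _ (⟨a, b, rfl⟩ | ⟨σ, a, rfl⟩)
  · obtain ⟨k, hk, z, hz, -, rfl⟩ := h a
    obtain ⟨l, hl, w, hw, -, rfl⟩ := h b
    refine Subgroup.subset_closure (Or.inl ⟨k, hk, l, hl, ?_⟩)
    rw [Subgroup.mem_center_iff] at hz hw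
    calc k * z * (l * w) * (k * z)⁻¹ * (l * w)⁻¹
        = k * (z * (l * w)) * z⁻¹ * k⁻¹ * w⁻¹ * l⁻¹ := by group
      _ = k * l * (w * k⁻¹) * w⁻¹ * l⁻¹ := by rw [← hz]; group
      _ = k * l * k⁻¹ * l⁻¹ := by rw [← hw]; group
  · obtain ⟨k, hk, z, -, hz, rfl⟩ := h a
    exact Subgroup.subset_closure (Or.inr ⟨σ, k, hk, by simp [smul_mul', hz, mul_assoc]⟩)

/-- If `φ : X →* G` is a central Γ-equivariant extension of a Γ-perfect
Γ-group `G`, then the Γ-commutator subgroup `X' = [X,X]_Γ` of `X` is itself Γ-perfect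
(`[X',X']_Γ = X'`) and `φ` maps `X'` onto `G`. -/
theorem gammaCommutator_gammaPerfect_and_maps_onto {Γ : Type u} [Group Γ] {X G : Type v}
    [Group X] [Group G] [MulDistribMulAction Γ X] [MulDistribMulAction Γ G]
    (φ : X →* G) (hφ : IsCentralGammaExt Γ φ) (hG : gammaCommutator Γ G = ⊤) :
    gammaCommutatorOn (Γ := Γ) (gammaCommutator Γ X) = gammaCommutator Γ X ∧
      ∀ g : G, ∃ x ∈ gammaCommutator Γ X, φ x = g := by
  obtain ⟨hsmul, hsurj, hcent, hfix, -⟩ := hφ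
  have honto : ∀ g : G, ∃ x ∈ gammaCommutator Γ X, φ x = g := fun g =>
    gammaCommutator_le_map φ hsmul hsurj (hG ▸ Subgroup.mem_top g)
  refine ⟨le_antisymm (gammaCommutatorOn_le fun σ x hx => gammaCommutator_smul_mem σ hx)
    (gammaCommutator_le_gammaCommutatorOn fun x => ?_), honto⟩
  obtain ⟨k, hk, hkx⟩ := honto (φ x)
  have hz : k⁻¹ * x ∈ φ.ker := by simp [MonoidHom.mem_ker, hkx]
  exact ⟨k, hk, k⁻¹ * x, hcent hz, fun σ => hfix σ _ hz, by group⟩
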